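/- arXiv:2602.13914 — 4 statements merged into one kernel-verified Lean document; each statement's English description precedes it below -/
import Mathlib

section
/- Let W be a set and R a weakly transitive binary relation on W, i.e., for all w, s, t ∈ W, if w R s and s R t then w R t or w = t. Define d(A) = {w ∈ W : ∃ s ∈ A, w R s}. Then (W, d) is a derivative space: d(∅) = ∅, d(A ∪ B) = d(A) ∪ d(B), and d(d(A)) ⊆ A ∪ d(A) for all A, B ⊆ W. -/
/-- The relational derivative of a binary relation: `w ∈ relDeriv R A` iff `w` sees
some point of `A`. -/
def relDeriv {W : Type*} (R : W → W → Prop) (A : Set W) : Set W :=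
  {w | ∃ s ∈ A, R w s}

/-- Every weakly transitive frame gives rise to a derivative space. -/
theorem relDeriv_is_derivative_space {W : Type*} (R : W → W → Prop)
    (hwt : ∀ w s t : W, R w s → R s t → R w t ∨ w = t) :
    relDeriv R ∅ = ∅ ∧
    (∀ A B : Set W, relDeriv R (A ∪ B) = relDeriv R A ∪ relDeriv R B) ∧
    (∀ A : Set W, relDeriv R (relDeriv R A) ⊆ A ∪ relDeriv R A) := by
  refine ⟨?_, fun A B => ?_, fun A => ?_⟩
  · simp [relDeriv]
  · ext w
    simp only [relDeriv, Set.mem_ofPred_eq, Set.mem_union, or_and_right, exists_or]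
  · rintro w ⟨s, ⟨t, ht, hst⟩, hws⟩
    rcases hwt w s t hws hst with hwt' | rfl
    · exact Or.inr ⟨t, ht, hwt'⟩
    · exact Or.inl ht
end

section
/- Let X be an Alexandrov-discrete topological space and let d denote the Cantor derivative (derived-set) operator. Then for every A ⊆ X, d(A) = {x ∈ X : ∃ y ∈ A, x ≠ y and x ∈ closure{y}}; i.e., the Cantor derivative coincides with the relational derivative of the irreflexive specialization relation. -/
/-- The Cantor derivative (derived set) operator of a topological space. -/
def cantorDeriv {X : Type*} [TopologicalSpace X] (A : Set X) : Set X :=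
  {x | ∀ U : Set X, IsOpen U → x ∈ U → (A ∩ (U \ {x})).Nonempty}

/-- In an Alexandrov-discrete space, the Cantor derivative coincides with the relational
derivative of the irreflexive specialization relation. -/
theorem alexandrov_cantorDeriv_eq_relational {X : Type*} [TopologicalSpace X]
    [AlexandrovDiscrete X] (A : Set X) :
    cantorDeriv A = {x : X | ∃ y ∈ A, x ≠ y ∧ x ∈ closure {y}} := by
  ext x
  constructor
  · intro hx
    obtain ⟨y, hyA, hy, hyx⟩ := hx (nhdsKer {x}) isOpen_nhdsKer (subset_nhdsKer rfl)
    exact ⟨y, hyA, Ne.symm hyx, (mem_nhdsKer_singleton.1 hy).mem_closure⟩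
  · rintro ⟨y, hyA, hxy, hy⟩ U hU hxU
    exact ⟨y, hyA, (specializes_iff_mem_closure.2 hy).mem_open hU hxU, hxy.symm⟩
end

section
/- Let X be a set, let (t_i)_{i ∈ I} be a family of topologies on X, and let t be the topology on X whose open sets are exactly those sets that are open in every t_i. Then for every Y ⊆ X, the least set Z ⊇ Y satisfying closure_{t_i}(Z) ⊆ Z for all i ∈ I (i.e., the intersection of all Z with Y ∪ ⋃_{i} closure_{t_i}(Z) ⊆ Z) equals the closure of Y with respect to t. Equivalently, x lies in this least set iff every set containing x that is open in all of the topologies t_i meets Y. -/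
/-- A set is closed in the intersection topology iff it contains its closure in each topology of
the family. -/
theorem isClosed_iff_forall_closure_subset {X : Type*} {I : Type*}
    {t : I → TopologicalSpace X} {t₀ : TopologicalSpace X}
    (ht₀ : ∀ U : Set X, @IsOpen X t₀ U ↔ ∀ i, @IsOpen X (t i) U) (Z : Set X) :
    @IsClosed X t₀ Z ↔ ∀ i, @closure X (t i) Z ⊆ Z := by
  rw [← @isOpen_compl_iff X Z t₀, ht₀]
  exact forall_congr' fun i =>
    (@isOpen_compl_iff X Z (t i)).trans (@closure_subset_iff_isClosed X (t i) Z).symm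

/-- Topological characterization of common knowledge: the least superset of `Y` that is
closed under the closure operators of each of the topologies `t i` equals the closure of
`Y` in the intersection topology `t₀` (the topology whose open sets are exactly the sets
open in every `t i`); equivalently, a point belongs to this least set iff every set
containing it that is open in all the topologies `t i` meets `Y`. -/
theorem common_knowledge_closure {X : Type*} {I : Type*}
    (t : I → TopologicalSpace X) (t₀ : TopologicalSpace X)
    (ht₀ : ∀ U : Set X, @IsOpen X t₀ U ↔ ∀ i, @IsOpen X (t i) U)
    (Y : Set X) :
    ⋂₀ {Z : Set X | Y ⊆ Z ∧ ∀ i, @closure X (t i) Z ⊆ Z} = @closure X t₀ Y ∧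
    (∀ x : X,
      x ∈ ⋂₀ {Z : Set X | Y ⊆ Z ∧ ∀ i, @closure X (t i) Z ⊆ Z} ↔
      ∀ U : Set X, (∀ i, @IsOpen X (t i) U) → x ∈ U → (U ∩ Y).Nonempty) := by
  have h : ⋂₀ {Z : Set X | Y ⊆ Z ∧ ∀ i, @closure X (t i) Z ⊆ Z} = @closure X t₀ Y := by
    simp only [← isClosed_iff_forall_closure_subset ht₀, and_comm]
    rfl
  refine ⟨h, fun x => ?_⟩
  rw [h, @mem_closure_iff X t₀]
  simp only [ht₀]
end

section
/- Let X be a topological space with Cantor derivative operator d, and let W ⊆ X satisfy the Two condition: for every x ∈ X, if x ∈ W then x ∉ d(W) and x ∈ d(X \ W), and if x ∉ W then x ∉ d(X \ W) and x ∈ d(W). Then for every x ∈ X there exists a unique y ∈ X such that y ≠ x and {x, y} is an atomic open set (i.e., {x, y} is open and has no nonempty proper open subset). -/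
/-- An atomic open set: a nonempty open set with no nonempty proper open subset. -/
def IsAtomicOpen {X : Type*} [TopologicalSpace X] (U : Set X) : Prop :=
  IsOpen U ∧ U.Nonempty ∧ ∀ V : Set X, IsOpen V → V.Nonempty → V ⊆ U → V = U

theorem exists_isOpen_of_notMem_cantorDeriv {X : Type*} [TopologicalSpace X] {A : Set X} {x : X}
    (h : x ∉ cantorDeriv A) : ∃ U : Set X, IsOpen U ∧ x ∈ U ∧ ∀ z ∈ U, z ∈ A → z = x := by
  simp only [cantorDeriv, Set.mem_ofPred_eq, not_forall] at h
  obtain ⟨U, hU, hxU, hne⟩ := h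
  exact ⟨U, hU, hxU, fun z hz hzA => by_contra fun hzx => hne ⟨z, hzA, hz, hzx⟩⟩

/-- If every point of each of two covering sets is isolated in its own set and a limit point of
the other, then every point of the first set lies in a two-point atomic open set. -/
theorem exists_isAtomicOpen_pair {X : Type*} [TopologicalSpace X] {A B : Set X}
    (hAB : ∀ x, x ∈ A ∨ x ∈ B)
    (hA : ∀ x ∈ A, x ∉ cantorDeriv A ∧ x ∈ cantorDeriv B)
    (hB : ∀ x ∈ B, x ∉ cantorDeriv B ∧ x ∈ cantorDeriv A) {x : X} (hx : x ∈ A) :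
    ∃ y, y ≠ x ∧ IsAtomicOpen ({x, y} : Set X) := by
  obtain ⟨U, hU, hxU, hUA⟩ := exists_isOpen_of_notMem_cantorDeriv (hA x hx).1
  obtain ⟨y, hyB, hyU, hyx⟩ := (hA x hx).2 U hU hxU
  obtain ⟨V, hV, hyV, hVB⟩ := exists_isOpen_of_notMem_cantorDeriv (hB y hyB).1
  obtain ⟨z, hzA, hz, -⟩ := (hB y hyB).2 (U ∩ V) (hU.inter hV) ⟨hyU, hyV⟩
  obtain rfl := hUA z hz.1 hzA
  have hpair : ({z, y} : Set X) = U ∩ V := by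
    ext w
    constructor
    · rintro (rfl | rfl)
      exacts [hz, ⟨hyU, hyV⟩]
    · rintro ⟨hwU, hwV⟩
      exact (hAB w).imp (hUA w hwU) (hVB w hwV)
  refine ⟨y, hyx, hpair ▸ hU.inter hV, ⟨z, Or.inl rfl⟩, fun O hO hne hsub => ?_⟩
  have hzy : z ∈ O → y ∈ O := fun h => by
    obtain ⟨w, -, hwO, hwz⟩ := (hA z hx).2 O hO h
    obtain rfl := (hsub hwO).resolve_left hwz
    exact hwO
  have hyz : y ∈ O → z ∈ O := fun h => by
    obtain ⟨w, -, hwO, hwy⟩ := (hB y hyB).2 O hO h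
    obtain rfl := (hsub hwO).resolve_right hwy
    exact hwO
  refine hsub.antisymm (Set.pair_subset_iff.2 ?_)
  obtain ⟨w, hw⟩ := hne
  rcases hsub hw with rfl | rfl
  exacts [⟨hw, hzy hw⟩, ⟨hyz hw, hw⟩]

/-- Atomic open sets that share a point are equal. -/
theorem IsAtomicOpen.eq_of_mem {X : Type*} [TopologicalSpace X] {U V : Set X} {x : X}
    (hU : IsAtomicOpen U) (hV : IsAtomicOpen V) (hxU : x ∈ U) (hxV : x ∈ V) : U = V :=
  (hU.2.2 _ (hU.1.inter hV.1) ⟨x, hxU, hxV⟩ Set.inter_subset_left).symm.trans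
    (hV.2.2 _ (hU.1.inter hV.1) ⟨x, hxU, hxV⟩ Set.inter_subset_right)

/-- If `W` satisfies the `Two` condition, then every point `x` has a unique partner
`y ≠ x` such that `{x, y}` is an atomic open set. -/
theorem two_condition_unique_partner {X : Type*} [TopologicalSpace X] (W : Set X)
    (hTwo : ∀ x : X,
      (x ∈ W → x ∉ cantorDeriv W ∧ x ∈ cantorDeriv Wᶜ) ∧
      (x ∉ W → x ∉ cantorDeriv Wᶜ ∧ x ∈ cantorDeriv W)) :
    ∀ x : X, ∃! y : X, y ≠ x ∧ IsAtomicOpen ({x, y} : Set X) := by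
  intro x
  have hW : ∀ z ∈ W, z ∉ cantorDeriv W ∧ z ∈ cantorDeriv Wᶜ := fun z => (hTwo z).1
  have hWc : ∀ z ∈ Wᶜ, z ∉ cantorDeriv Wᶜ ∧ z ∈ cantorDeriv W := fun z => (hTwo z).2
  have hex : ∃ y, y ≠ x ∧ IsAtomicOpen ({x, y} : Set X) := by
    by_cases hx : x ∈ W
    · exact exists_isAtomicOpen_pair (fun z => Classical.em (z ∈ W)) hW hWc hx
    · exact exists_isAtomicOpen_pair (fun z => (Classical.em (z ∈ W)).symm) hWc hW hx
  obtain ⟨y, hyx, hy⟩ := hex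
  refine ⟨y, ⟨hyx, hy⟩, fun z ⟨hzx, hz⟩ => ?_⟩
  have hmem : z ∈ ({x, y} : Set X) :=
    hz.eq_of_mem hy (Or.inl rfl) (Or.inl rfl) ▸ Or.inr rfl
  exact hmem.resolve_left hzx
end
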